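/- arXiv:2007.09535 — 3 statements merged into one kernel-verified Lean document; each statement's English description precedes it below -/
import Mathlib

section
/- Let m ≥ 1 and p ≥ m be natural numbers, let a be a real number with m-1 < a < m, and let t > 0. Then (1/Γ(m-a)) · ∫_0^t (iteratedDeriv m (fun s => s^p)) (τ) · (t-τ)^{m-1-a} dτ = (Γ(p+1)/Γ(p+1-a)) · t^{p-a}, where (t-τ)^{m-1-a} and t^{p-a} are real powers. -/
open MeasureTheory intervalIntegral

/-- The real beta integral on `[0, t]`, evaluated in terms of the Gamma function. -/
theorem integral_rpow_mul_sub_rpow {u v t : ℝ} (hu : 0 < u) (hv : 0 < v) (ht : 0 < t) :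
    ∫ x in (0 : ℝ)..t, x ^ (u - 1) * (t - x) ^ (v - 1) =
      t ^ (u + v - 1) * (Real.Gamma u * Real.Gamma v / Real.Gamma (u + v)) := by
  have h := Complex.betaIntegral_scaled u v ht
  rw [Complex.betaIntegral_eq_Gamma_mul_div u v (by simpa) (by simpa), ← Complex.ofReal_add,
    Complex.Gamma_ofReal, Complex.Gamma_ofReal, Complex.Gamma_ofReal] at h
  apply Complex.ofReal_injective
  rw [← intervalIntegral.integral_ofReal]
  push_cast [Complex.ofReal_cpow ht.le] at h ⊢
  rw [← h]
  refine intervalIntegral.integral_congr fun x hx => ?_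
  rw [Set.uIcc_of_le ht.le] at hx
  push_cast [Complex.ofReal_cpow hx.1, Complex.ofReal_cpow (sub_nonneg.2 hx.2)]
  rfl

theorem caputo_power_rule_nat (m p : ℕ) (hm : 1 ≤ m) (hp : m ≤ p) (a t : ℝ)
    (ha1 : (m : ℝ) - 1 < a) (ha2 : a < m) (ht : 0 < t) :
    (1 / Real.Gamma ((m : ℝ) - a)) *
        ∫ τ in (0:ℝ)..t, (iteratedDeriv m (fun s : ℝ => s ^ p)) τ * (t - τ) ^ ((m : ℝ) - 1 - a) =
      (Real.Gamma ((p : ℝ) + 1) / Real.Gamma ((p : ℝ) + 1 - a)) * t ^ ((p : ℝ) - a) := by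
  obtain ⟨k, rfl⟩ := Nat.exists_eq_add_of_le hp
  have hv : 0 < (m : ℝ) - a := sub_pos.2 ha2
  have hderiv (τ : ℝ) :
      iteratedDeriv m (fun s : ℝ => s ^ (m + k)) τ * (t - τ) ^ ((m : ℝ) - 1 - a) =
        (m + k).descFactorial m *
          (τ ^ ((k + 1 : ℝ) - 1) * (t - τ) ^ ((m : ℝ) - a - 1)) := by
    rw [iteratedDeriv_pow, Nat.add_sub_cancel_left, add_sub_cancel_right, Real.rpow_natCast,
      sub_right_comm (m : ℝ) 1 a, mul_assoc]
  have hfac : ((k.factorial : ℝ)) * (m + k).descFactorial m = (m + k).factorial := by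
    have := Nat.factorial_mul_descFactorial (Nat.le_add_right m k)
    rw [Nat.add_sub_cancel_left] at this
    exact_mod_cast this
  simp_rw [hderiv]
  rw [intervalIntegral.integral_const_mul, integral_rpow_mul_sub_rpow (by positivity) hv ht,
    Real.Gamma_nat_eq_factorial, Real.Gamma_nat_eq_factorial, ← hfac]
  have hΓ := (Real.Gamma_pos_of_pos hv).ne'
  rw [show (k + 1 : ℝ) + (m - a) - 1 = ((m + k : ℕ) : ℝ) - a by push_cast; ring,
    show (k + 1 : ℝ) + (m - a) = ((m + k : ℕ) : ℝ) + 1 - a by push_cast; ring]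
  field_simp
end

section
/- Let m ≥ 1 be a natural number, let p be a real number with p > m-1, let a be a real number with m-1 < a < m, and let t > 0. Then (1/Γ(m-a)) · ∫_0^t (iteratedDeriv m (fun s => s^p)) (τ) · (t-τ)^{m-1-a} dτ = (Γ(p+1)/Γ(p+1-a)) · t^{p-a}, where s^p, (t-τ)^{m-1-a} and t^{p-a} are real powers (rpow). -/
open MeasureTheory intervalIntegral

/-- The falling factorial as a quotient of Gamma values, in product form. -/
theorem descPochhammer_eval_mul_Gamma (m : ℕ) {p : ℝ} (hp : (m : ℝ) - 1 < p) :
    (descPochhammer ℝ m).eval p * Real.Gamma (p - m + 1) = Real.Gamma (p + 1) := by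
  induction m with
  | zero => simp
  | succ k ih =>
    push_cast at hp ⊢
    rw [← ih (by linarith), descPochhammer_succ_eval, Real.Gamma_add_one (s := p - k) (by linarith),
      show p - (k + 1) + 1 = p - k by ring, mul_assoc]

theorem caputo_power_rule_rpow (m : ℕ) (hm : 1 ≤ m) (p a t : ℝ)
    (hp : p > (m : ℝ) - 1)
    (ha1 : (m : ℝ) - 1 < a) (ha2 : a < m) (ht : 0 < t) :
    (1 / Real.Gamma ((m : ℝ) - a)) *
        ∫ τ in (0:ℝ)..t, (iteratedDeriv m (fun s : ℝ => s ^ p)) τ * (t - τ) ^ ((m : ℝ) - 1 - a) =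
      (Real.Gamma (p + 1) / Real.Gamma (p + 1 - a)) * t ^ (p - a) := by
  have hu : 0 < p - m + 1 := by linarith
  have hv : 0 < (m : ℝ) - a := by linarith
  have hΓ := (Real.Gamma_pos_of_pos hv).ne'
  have h := integral_rpow_mul_sub_rpow hu hv ht
  rw [show p - m + 1 - 1 = p - m by ring, show (m : ℝ) - a - 1 = m - 1 - a by ring,
    show p - m + 1 + (m - a) - 1 = p - a by ring,
    show p - m + 1 + (m - a) = p + 1 - a by ring] at h
  simp only [iteratedDeriv_eq_iterate, Real.iter_deriv_rpow_const, mul_assoc]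
  rw [intervalIntegral.integral_const_mul, h, ← descPochhammer_eval_mul_Gamma m hp]
  field_simp
end

section
/- Let a, t, x be real numbers with 0 < a < 1 and t > 0, and define u : ℝ × ℝ → ℂ by u(y,s) = s²·(cos y + i·sin y). Then i · (1/Γ(1-a)) · ∫_0^t (deriv (fun s => u(x,s))) (τ) · (t-τ)^{-a} dτ + (iteratedDeriv 2 (fun y => u(y,t))) (x) = f(x,t), where f(x,t) = -(2·t^{2-a}/Γ(3-a))·sin x - t²·cos x + i·((2·t^{2-a}/Γ(3-a))·cos x - t²·sin x), the powers (t-τ)^{-a} and t^{2-a} are real powers, and Γ is the real Gamma function. -/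
open MeasureTheory intervalIntegral

/-- The beta-type integral `∫₀ᵗ τ (t - τ)^{-a} dτ`. -/
theorem integral_mul_sub_rpow_neg {a t : ℝ} (ha : a < 1) (ht : 0 < t) :
    ∫ τ in (0:ℝ)..t, τ * (t - τ) ^ (-a) = t ^ (2 - a) / ((1 - a) * (2 - a)) := by
  have reflect : ∫ τ in (0:ℝ)..t, τ * (t - τ) ^ (-a) =
      ∫ s in (0:ℝ)..t, (t - s) * s ^ (-a) := by
    have h := intervalIntegral.integral_comp_sub_left (a := 0) (b := t)
      (fun s : ℝ => (t - s) * s ^ (-a)) t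
    simpa using h
  have split : ∫ s in (0:ℝ)..t, (t - s) * s ^ (-a) =
      ∫ s in (0:ℝ)..t, (t * s ^ (-a) - s ^ (1 - a)) := by
    refine intervalIntegral.integral_congr fun s hs => ?_
    rw [Set.uIcc_of_le ht.le] at hs
    have h : s ^ (1 - a) = s * s ^ (-a) := by
      rw [sub_eq_add_neg, Real.rpow_add' hs.1 (by linarith), Real.rpow_one]
    simp only [h]
    ring
  rw [reflect, split, intervalIntegral.integral_sub
      ((intervalIntegrable_rpow' (by linarith)).const_mul t)
      (intervalIntegrable_rpow' (by linarith)),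
    intervalIntegral.integral_const_mul, integral_rpow (Or.inl (by linarith)),
    integral_rpow (Or.inl (by linarith)), Real.zero_rpow (by linarith),
    Real.zero_rpow (by linarith)]
  have e₁ : -a + 1 = 1 - a := by ring
  have e₂ : 1 - a + 1 = 2 - a := by ring
  have h : t ^ (2 - a) = t * t ^ (1 - a) := by
    rw [← e₂, Real.rpow_add_one ht.ne', mul_comm]
  rw [e₁, e₂, h]
  have h₁ : 1 - a ≠ 0 := by linarith
  have h₂ : 2 - a ≠ 0 := by linarith
  field_simp
  ring

/-- The Caputo derivative of order `a` of `t ↦ t²`. -/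
theorem caputo_sq {a t : ℝ} (ha : a < 1) (ht : 0 < t) :
    1 / Real.Gamma (1 - a) * (2 * ∫ τ in (0:ℝ)..t, τ * (t - τ) ^ (-a)) =
      2 * t ^ (2 - a) / Real.Gamma (3 - a) := by
  have h₁ : 1 - a ≠ 0 := by linarith
  have h₂ : 2 - a ≠ 0 := by linarith
  have hΓ : Real.Gamma (3 - a) = (2 - a) * ((1 - a) * Real.Gamma (1 - a)) := by
    rw [← Real.Gamma_add_one h₁, show 1 - a + 1 = 2 - a by ring, ← Real.Gamma_add_one h₂]
    congr 1
    ring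
  have hpos : Real.Gamma (1 - a) ≠ 0 := (Real.Gamma_pos_of_pos (by linarith)).ne'
  rw [integral_mul_sub_rpow_neg ha ht, hΓ]
  field_simp

theorem deriv_ofReal_sq_mul (c : ℂ) (τ : ℝ) :
    deriv (fun s : ℝ => (s : ℂ) ^ 2 * c) τ = 2 * c * (τ : ℂ) := by
  have h : HasDerivAt (fun s : ℝ => (s : ℂ) ^ 2 * c) _ τ :=
    ((Complex.ofRealCLM.hasDerivAt (x := τ)).pow 2).mul_const c
  rw [h.deriv]
  simp
  ring

/-- `y ↦ c (cos y + i sin y)` is an eigenfunction of the second derivative. -/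
theorem iteratedDeriv_two_const_mul_cos_add_I_mul_sin (c : ℂ) (x : ℝ) :
    iteratedDeriv 2 (fun y : ℝ => c * ((Real.cos y : ℂ) + Complex.I * (Real.sin y : ℂ))) x =
      -(c * ((Real.cos x : ℂ) + Complex.I * (Real.sin x : ℂ))) := by
  have h (d : ℂ) (y : ℝ) :
      HasDerivAt (fun y : ℝ => d * ((Real.cos y : ℂ) + Complex.I * (Real.sin y : ℂ)))
        (d * Complex.I * ((Real.cos y : ℂ) + Complex.I * (Real.sin y : ℂ))) y := by
    refine HasDerivAt.congr_deriv (((Real.hasDerivAt_cos y).ofReal_comp.add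
      ((Real.hasDerivAt_sin y).ofReal_comp.const_mul Complex.I)).const_mul d) ?_
    push_cast
    linear_combination -d * Complex.sin y * Complex.I_mul_I
  have hderiv (d : ℂ) := funext fun y => (h d y).deriv
  rw [iteratedDeriv_succ', iteratedDeriv_one, hderiv, hderiv, mul_assoc c, Complex.I_mul_I]
  ring

theorem example5_exact_solution (a t x : ℝ)
    (ha1 : 0 < a) (ha2 : a < 1) (ht : 0 < t)
    (u : ℝ × ℝ → ℂ)
    (hu : u = fun p => ((p.2 : ℂ)) ^ 2 * ((Real.cos p.1 : ℂ) + Complex.I * (Real.sin p.1 : ℂ)))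
    (f : ℝ → ℝ → ℂ)
    (hf : f = fun y s =>
      -(((2 * s ^ (2 - a) / Real.Gamma (3 - a) : ℝ) : ℂ)) * (Real.sin y : ℂ)
        - ((s : ℂ)) ^ 2 * (Real.cos y : ℂ)
        + Complex.I * (((2 * s ^ (2 - a) / Real.Gamma (3 - a) : ℝ) : ℂ) * (Real.cos y : ℂ)
            - ((s : ℂ)) ^ 2 * (Real.sin y : ℂ))) :
    Complex.I * (((1 / Real.Gamma (1 - a) : ℝ) : ℂ) *
          ∫ τ in (0:ℝ)..t, (deriv (fun s => u (x, s))) τ * (((t - τ) ^ (-a) : ℝ) : ℂ)) +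
        (iteratedDeriv 2 (fun y => u (y, t))) x =
      f x t := by
  subst hu hf
  set c : ℂ := (Real.cos x : ℂ) + Complex.I * (Real.sin x : ℂ) with hc
  have hint : ∫ τ in (0:ℝ)..t,
      deriv (fun s : ℝ => (s : ℂ) ^ 2 * c) τ * (((t - τ) ^ (-a) : ℝ) : ℂ) =
        c * ((2 * ∫ τ in (0:ℝ)..t, τ * (t - τ) ^ (-a) : ℝ) : ℂ) := by
    simp only [deriv_ofReal_sq_mul, mul_assoc, ← Complex.ofReal_mul]
    rw [intervalIntegral.integral_const_mul, intervalIntegral.integral_const_mul,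
      intervalIntegral.integral_ofReal]
    push_cast
    ring
  have hcaputo := congrArg Complex.ofReal (caputo_sq ha2 ht)
  rw [Complex.ofReal_mul] at hcaputo
  simp only [iteratedDeriv_two_const_mul_cos_add_I_mul_sin]
  rw [hint, mul_left_comm _ c, hcaputo, hc]
  linear_combination ((2 * t ^ (2 - a) / Real.Gamma (3 - a) : ℝ) : ℂ) * (Real.sin x : ℂ) *
    Complex.I_mul_I
end
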